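/- Let A,B ∈ ℝ^{3×3} with A − B = a ⊗ n for some a ∈ ℝ³ ∖ {0} and unit vector n ∈ S², let λ ∈ (0,1) and C = (1−λ)A + λB. Then for each δ ∈ (0,1/2), setting ε = 4√2·δ·λ(1−λ)|a|, there exist a diamond Ω_δ ⊂ ℝ³ of aspect ratio 1:δ:1 and a piecewise affine Lipschitz map u : Ω_δ → ℝ³ such that: u(x) = Cx on ∂Ω_δ; dist(∇u(x), {A,B}) ≤ ε and |u(x) − Cx| ≤ ε for a.e. x ∈ Ω_δ; and there exist a set Ω' ⊂ Ω_δ which is a union of level sets of ∇u and constants v_A, v_B ∈ (1/2,2) with dist(∇u, A) ≤ ε on Ω', |Ω'| = v_A(1−λ)|Ω_δ|, dist(∇u, B) ≤ ε on Ω_δ ∖ Ω', and |Ω_δ ∖ Ω'| = v_Bλ|Ω_δ|. -/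

import Mathlib

noncomputable section
open MeasureTheory Set ENNReal Matrix

abbrev Euc (n : ℕ) := EuclideanSpace ℝ (Fin n)
abbrev Mat (n : ℕ) := Matrix (Fin n) (Fin n) ℝ

/-- The Frobenius norm of a matrix. -/
def frobNorm {n : ℕ} (A : Mat n) : ℝ := Real.sqrt (∑ i, ∑ j, (A i j) ^ 2)

/-- The continuous linear map on Euclidean space induced by a matrix. -/
def matCLM {n : ℕ} (A : Mat n) : Euc n →L[ℝ] Euc n :=
  LinearMap.toContinuousLinearMap (Matrix.toEuclideanLin A)

/-- A matrix applied to a vector in Euclidean space. -/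
def matVec {n : ℕ} (A : Mat n) (x : Euc n) : Euc n := matCLM A x

/-- The vertices `±e₁, ±δe₂ (, ±e₃)` of the model diamond. -/
def diamondVertices (n : ℕ) (δ : ℝ) : Set (Euc n) :=
  {v | ∃ i : Fin n, v = (if (i : ℕ) = 1 then δ else 1) • EuclideanSpace.single i (1 : ℝ) ∨
       v = -((if (i : ℕ) = 1 then δ else 1) • EuclideanSpace.single i (1 : ℝ))}

/-- The model diamond `conv{±e₁, ±δe₂ (, ±e₃)}`. -/
def baseDiamond (n : ℕ) (δ : ℝ) : Set (Euc n) := convexHull ℝ (diamondVertices n δ)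

/-- A diamond of aspect ratio `1:δ` (resp. `1:δ:1`): a translated, rescaled and
rotated copy of the model diamond. -/
def IsDiamond (n : ℕ) (δ : ℝ) (Ω : Set (Euc n)) : Prop :=
  ∃ (x₀ : Euc n) (r : ℝ) (Q : Mat n), 0 < r ∧ Qᵀ * Q = 1 ∧ Q.det = 1 ∧
    Ω = (fun y => x₀ + r • matVec Q y) '' baseDiamond n δ

/-- A continuous map which is affine on each polytope of a finite cover of `Ω`. -/
def IsPiecewiseAffine {n : ℕ} (Ω : Set (Euc n)) (u : Euc n → Euc n) : Prop :=
  ContinuousOn u Ω ∧ ∃ (N : ℕ) (P : Fin N → Set (Euc n)),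
    (∀ i, ∃ S : Finset (Euc n), P i = convexHull ℝ (S : Set (Euc n))) ∧
    Ω ⊆ ⋃ i, P i ∧
    (∀ i, ∃ (f : Euc n →ₗ[ℝ] Euc n) (b : Euc n), ∀ x ∈ P i ∩ Ω, u x = f x + b)

/-! ### The model diamond -/

/-- The gauge whose closed unit ball is the model diamond of aspect ratio `1:δ:1`. -/
def diamondGauge (δ : ℝ) (y : Euc 3) : ℝ := |y 0| + |y 1| / δ + |y 2|

lemma continuous_diamondGauge (δ : ℝ) : Continuous (diamondGauge δ) := by
  unfold diamondGauge; fun_prop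

lemma convex_diamondGauge_le_one {δ : ℝ} (hδ : 0 < δ) : Convex ℝ {y | diamondGauge δ y ≤ 1} := by
  intro x hx y hy s t hs ht hst
  simp only [mem_ofPred_eq, diamondGauge, PiLp.add_apply, PiLp.smul_apply, smul_eq_mul] at *
  have key (p q : ℝ) : |s * p + t * q| ≤ s * |p| + t * |q| := by
    calc |s * p + t * q| ≤ |s * p| + |t * q| := abs_add_le _ _
      _ = s * |p| + t * |q| := by rw [abs_mul, abs_mul, abs_of_nonneg hs, abs_of_nonneg ht]
  have h1 : |s * x 1 + t * y 1| / δ ≤ s * (|x 1| / δ) + t * (|y 1| / δ) := by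
    rw [← mul_div_assoc, ← mul_div_assoc, ← add_div]
    gcongr
    exact key _ _
  nlinarith [key (x 0) (y 0), key (x 2) (y 2), h1, mul_le_mul_of_nonneg_left hx hs,
    mul_le_mul_of_nonneg_left hy ht]

/-- The sign encoded by a Boolean. -/
def boolSign (s : Bool) : ℝ := if s then 1 else -1

lemma exists_boolSign (t : ℝ) : ∃ s, t = boolSign s * |t| := by
  rcases le_total 0 t with h | h
  · exact ⟨true, by simp [boolSign, abs_of_nonneg h]⟩
  · exact ⟨false, by simp [boolSign, abs_of_nonpos h]⟩

lemma boolSign_mul_self (s : Bool) : boolSign s * boolSign s = 1 := by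
  cases s <;> simp [boolSign]

lemma abs_eq_boolSign_mul {s : Bool} {t : ℝ} (h : 0 ≤ boolSign s * t) : |t| = boolSign s * t := by
  cases s
  · simp only [boolSign, Bool.false_eq_true, if_false] at *
    rw [abs_of_nonpos (by linarith)]; ring
  · simp only [boolSign, if_true] at *
    rw [abs_of_nonneg (by linarith)]; ring

/-- The vertex of the model diamond on the `i`-th axis, on the side given by `s`. -/
def axisVertex (i : Fin 3) (c : ℝ) (s : Bool) : Euc 3 :=
  EuclideanSpace.single i (boolSign s * c)

lemma axisVertex_mem_diamondVertices (δ : ℝ) (i : Fin 3) (s : Bool) :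
    axisVertex i (if (i : ℕ) = 1 then δ else 1) s ∈ diamondVertices 3 δ := by
  refine ⟨i, ?_⟩
  generalize (if (i : ℕ) = 1 then δ else 1) = c
  cases s
  · right
    ext j
    by_cases h : j = i <;> simp [axisVertex, boolSign, h]
  · left
    ext j
    by_cases h : j = i <;> simp [axisVertex, boolSign, h]

lemma zero_mem_baseDiamond (δ : ℝ) : (0 : Euc 3) ∈ baseDiamond 3 δ := by
  have h (s : Bool) : axisVertex 0 1 s ∈ baseDiamond 3 δ :=
    subset_convexHull ℝ _ (axisVertex_mem_diamondVertices δ 0 s)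
  have := (convex_convexHull ℝ (diamondVertices 3 δ)) (h true) (h false)
    (by norm_num : (0 : ℝ) ≤ 1 / 2) (by norm_num : (0 : ℝ) ≤ 1 / 2) (by norm_num)
  refine Eq.subst (motive := fun z => z ∈ baseDiamond 3 δ) ?_ this
  ext j
  by_cases h : j = 0 <;> simp [axisVertex, boolSign, h]

lemma Convex.combination_four_mem {E : Type*} [AddCommGroup E] [Module ℝ E] {K : Set E}
    (hK : Convex ℝ K) {z₀ z₁ z₂ z₃ : E} (h₀ : z₀ ∈ K) (h₁ : z₁ ∈ K) (h₂ : z₂ ∈ K) (h₃ : z₃ ∈ K)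
    {w₀ w₁ w₂ w₃ : ℝ} (p₀ : 0 ≤ w₀) (p₁ : 0 ≤ w₁) (p₂ : 0 ≤ w₂) (p₃ : 0 ≤ w₃)
    (hw : w₀ + w₁ + w₂ + w₃ = 1) : w₀ • z₀ + w₁ • z₁ + w₂ • z₂ + w₃ • z₃ ∈ K := by
  have := hK.sum_mem (t := Finset.univ) (w := ![w₀, w₁, w₂, w₃]) (z := ![z₀, z₁, z₂, z₃])
    (by intro i _; fin_cases i <;> simpa) (by simpa [Fin.sum_univ_four] using hw)
    (by intro i _; fin_cases i <;> simpa)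
  simpa [Fin.sum_univ_four] using this

lemma baseDiamond_eq {δ : ℝ} (hδ : 0 < δ) :
    baseDiamond 3 δ = {y | diamondGauge δ y ≤ 1} := by
  apply Subset.antisymm
  · refine convexHull_min ?_ (convex_diamondGauge_le_one hδ)
    rintro v ⟨i, rfl | rfl⟩ <;> fin_cases i <;>
      simp [diamondGauge, abs_of_pos hδ, div_self hδ.ne']
  · intro y hy
    simp only [mem_ofPred_eq, diamondGauge] at hy
    obtain ⟨s₀, h₀⟩ := exists_boolSign (y 0)
    obtain ⟨s₁, h₁⟩ := exists_boolSign (y 1)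
    obtain ⟨s₂, h₂⟩ := exists_boolSign (y 2)
    have := Convex.combination_four_mem (convex_convexHull ℝ (diamondVertices 3 δ))
      (subset_convexHull ℝ _ (axisVertex_mem_diamondVertices δ 0 s₀))
      (subset_convexHull ℝ _ (axisVertex_mem_diamondVertices δ 1 s₁))
      (subset_convexHull ℝ _ (axisVertex_mem_diamondVertices δ 2 s₂))
      (zero_mem_baseDiamond δ)
      (abs_nonneg (y 0)) (div_nonneg (abs_nonneg (y 1)) hδ.le) (abs_nonneg (y 2))
      (w₃ := 1 - (|y 0| + |y 1| / δ + |y 2|)) (by linarith) (by ring)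
    refine Eq.subst (motive := fun z => z ∈ baseDiamond 3 δ) ?_ this
    ext j
    fin_cases j
    · simpa [axisVertex, mul_comm] using h₀.symm
    · simp [axisVertex]
      rw [div_mul_eq_mul_div, div_eq_iff hδ.ne']
      linear_combination -δ * h₁
    · simpa [axisVertex, mul_comm] using h₂.symm

/-! ### The scalar profile -/

/-- The half-width, in direction `e₂`, of the thin diamond of aspect ratio `1:(lam * δ):1`. -/
def halfWidth (lam δ : ℝ) (y : Euc 3) : ℝ := lam * δ * (1 - |y 0| - |y 2|)

/-- The scalar profile: its gradient is `-(1 - lam) • e₂` on the thin diamond of aspect ratio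
`1:(lam * δ):1` and close to `lam • e₂` on the rest of the diamond of aspect ratio `1:δ:1`. -/
def profile (lam δ : ℝ) (y : Euc 3) : ℝ :=
  lam * y 1 + max (-halfWidth lam δ y) (min (halfWidth lam δ y) (-y 1))

lemma diamondGauge_le_one_iff {lam δ : ℝ} (hl : 0 < lam) (hδ : 0 < δ) (y : Euc 3) :
    diamondGauge (lam * δ) y ≤ 1 ↔ |y 1| ≤ halfWidth lam δ y := by
  have h : 0 < lam * δ := mul_pos hl hδ
  rw [diamondGauge, halfWidth, ← div_le_iff₀' h]
  constructor <;> intro h <;> linarith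

lemma abs_le_mul_of_diamondGauge_le_one {δ : ℝ} (hδ : 0 < δ) {y : Euc 3}
    (hy : diamondGauge δ y ≤ 1) : |y 1| ≤ δ * (1 - |y 0| - |y 2|) := by
  rw [diamondGauge] at hy
  rw [← div_le_iff₀' hδ]
  linarith

lemma profile_eq_of_abs_le {lam δ : ℝ} {y : Euc 3} (h : |y 1| ≤ halfWidth lam δ y) :
    profile lam δ y = -(1 - lam) * y 1 := by
  have := abs_le.1 h
  rw [profile, min_eq_right (by linarith), max_eq_right (by linarith)]
  ring

lemma profile_eq_of_le {lam δ : ℝ} {y : Euc 3} (h₀ : 0 ≤ halfWidth lam δ y)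
    (h : halfWidth lam δ y ≤ y 1) : profile lam δ y = lam * y 1 - halfWidth lam δ y := by
  rw [profile, min_eq_right (by linarith), max_eq_left (by linarith)]
  ring

lemma profile_eq_of_le_neg {lam δ : ℝ} {y : Euc 3} (h₀ : 0 ≤ halfWidth lam δ y)
    (h : halfWidth lam δ y ≤ -y 1) : profile lam δ y = lam * y 1 + halfWidth lam δ y := by
  rw [profile, min_eq_left (by linarith), max_eq_right (by linarith)]

lemma profile_eq_zero {lam δ : ℝ} (hl : lam ∈ Ioo 0 1) (hδ : 0 < δ) {y : Euc 3}
    (hy : diamondGauge δ y = 1) : profile lam δ y = 0 := by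
  have h : |y 1| = δ * (1 - |y 0| - |y 2|) := by
    rw [diamondGauge] at hy
    rw [mul_comm, ← div_eq_iff hδ.ne']
    linarith
  have hw : halfWidth lam δ y = lam * |y 1| := by rw [halfWidth, h]; ring
  have hn : lam * |y 1| ≤ |y 1| := mul_le_of_le_one_left (abs_nonneg _) hl.2.le
  have h₀ : 0 ≤ halfWidth lam δ y := by rw [hw]; exact mul_nonneg hl.1.le (abs_nonneg _)
  rcases le_total 0 (y 1) with hs | hs
  · rw [abs_of_nonneg hs] at hw hn
    rw [profile_eq_of_le h₀ (by linarith), hw]; ring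
  · rw [abs_of_nonpos hs] at hw hn
    rw [profile_eq_of_le_neg h₀ (by linarith), hw]; ring

lemma abs_profile_le {lam δ : ℝ} (hl : lam ∈ Ioo 0 1) (hδ : 0 < δ) {y : Euc 3}
    (hy : diamondGauge δ y ≤ 1) : |profile lam δ y| ≤ δ * lam * (1 - lam) := by
  have h := abs_le_mul_of_diamondGauge_le_one hδ hy
  have hr : 0 ≤ |y 0| + |y 2| := by positivity
  have hy1 := abs_nonneg (y 1)
  obtain ⟨hl0, hl1⟩ := hl
  have hw : halfWidth lam δ y = lam * (δ * (1 - |y 0| - |y 2|)) := by rw [halfWidth]; ring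
  have hw1 : δ * (1 - |y 0| - |y 2|) ≤ δ := by nlinarith
  set k := δ * (1 - |y 0| - |y 2|)
  have hk : 0 ≤ k := hy1.trans h
  have h₀ : 0 ≤ halfWidth lam δ y := by rw [hw]; positivity
  have hkδ : lam * (1 - lam) * k ≤ lam * (1 - lam) * δ :=
    mul_le_mul_of_nonneg_left hw1 (mul_nonneg hl0.le (by linarith))
  rcases le_total (|y 1|) (halfWidth lam δ y) with hc | hc
  · rw [profile_eq_of_abs_le hc, abs_mul, abs_neg, abs_of_pos (by linarith : 0 < 1 - lam)]
    rw [hw] at hc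
    nlinarith
  · have h2 : |profile lam δ y| = |lam * |y 1| - halfWidth lam δ y| := by
      rcases le_total 0 (y 1) with hs | hs
      · rw [abs_of_nonneg hs] at hc ⊢
        rw [profile_eq_of_le h₀ hc]
      · rw [abs_of_nonpos hs] at hc ⊢
        rw [profile_eq_of_le_neg h₀ hc, ← abs_neg]
        congr 1; ring
    rw [h2, hw] at *
    rw [abs_le]
    constructor <;> nlinarith

lemma exists_lipschitzWith_profile (lam δ : ℝ) : ∃ L, LipschitzWith L (profile lam δ) := by
  have hp (i : Fin 3) : LipschitzWith 1 (fun y : Euc 3 => y i) := by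
    refine LipschitzWith.of_dist_le_mul fun x y => ?_
    simpa [dist_eq_norm] using PiLp.norm_apply_le (x - y) i
  have ha (i : Fin 3) : LipschitzWith (1 * 1) (fun y : Euc 3 => |y i|) :=
    (lipschitzWith_one_norm (E := ℝ)).comp (hp i)
  have hm (c : ℝ) {K : NNReal} {f : Euc 3 → ℝ} (hf : LipschitzWith K f) :
      LipschitzWith (‖c‖₊ * K) (fun y => c * f y) :=
    (lipschitzWith_smul c).comp hf
  have hw := hm (lam * δ) (((LipschitzWith.const (α := Euc 3) (1 : ℝ)).sub (ha 0)).sub (ha 2))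
  exact ⟨_, (hm lam (hp 1)).add (hw.neg.max (hw.min (hp 1).neg))⟩

/-- The gradient of the profile. -/
def profileGrad (lam δ : ℝ) (y : Euc 3) : Euc 3 :=
  open Classical in
  if |y 1| ≤ halfWidth lam δ y then EuclideanSpace.single 1 (-(1 - lam))
  else !₂[lam * δ * SignType.sign (y 1) * SignType.sign (y 0), lam,
    lam * δ * SignType.sign (y 1) * SignType.sign (y 2)]

lemma norm_profileGrad_sub_le {lam δ : ℝ} (hl : 0 < lam) (hδ : 0 < δ) {y : Euc 3}
    (h : ¬ |y 1| ≤ halfWidth lam δ y) :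
    ‖profileGrad lam δ y - EuclideanSpace.single 1 lam‖ ≤ Real.sqrt 2 * (lam * δ) := by
  have hs (t : ℝ) : ((SignType.sign t : SignType) : ℝ) ^ 2 ≤ 1 := by
    cases SignType.sign t <;> simp
  have h0 : 0 ≤ lam * δ := by positivity
  rw [EuclideanSpace.norm_eq, ← Real.sqrt_sq h0, ← Real.sqrt_mul (by norm_num)]
  apply Real.sqrt_le_sqrt
  have hb (t : ℝ) : (lam * δ * SignType.sign (y 1) * SignType.sign t) ^ 2 ≤ (lam * δ) ^ 2 := by
    have := mul_le_mul (hs (y 1)) (hs t) (sq_nonneg _) zero_le_one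
    have h2 := mul_le_mul_of_nonneg_left this (sq_nonneg (lam * δ))
    nlinarith
  simp only [profileGrad, if_neg h, Fin.sum_univ_three, Real.norm_eq_abs, sq_abs]
  simp
  linarith [hb (y 0), hb (y 2)]

lemma hasFDerivAt_coord (i : Fin 3) (y : Euc 3) :
    HasFDerivAt (fun y : Euc 3 => y i) (EuclideanSpace.proj i : Euc 3 →L[ℝ] ℝ) y :=
  (EuclideanSpace.proj i : Euc 3 →L[ℝ] ℝ).hasFDerivAt

lemma continuous_halfWidth (lam δ : ℝ) : Continuous (halfWidth lam δ) := by
  unfold halfWidth; fun_prop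

lemma hasFDerivAt_profile {lam δ : ℝ} (hl : 0 < lam) (hδ : 0 < δ) {y : Euc 3}
    (hy : diamondGauge δ y ≤ 1) (h0 : y 0 ≠ 0) (h1 : y 1 ≠ 0) (h2 : y 2 ≠ 0)
    (hne : |y 1| ≠ halfWidth lam δ y) :
    HasFDerivAt (profile lam δ) (innerSL ℝ (profileGrad lam δ y)) y := by
  have hc := continuous_halfWidth lam δ
  have hc1 : Continuous (fun y : Euc 3 => y 1) := by fun_prop
  have hw : HasFDerivAt (halfWidth lam δ) _ y :=
    ((((hasFDerivAt_coord 0 y).abs h0).const_sub 1).sub ((hasFDerivAt_coord 2 y).abs h2)).const_mul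
      (lam * δ)
  have hpos : 0 < halfWidth lam δ y := by
    have := abs_le_mul_of_diamondGauge_le_one hδ hy
    have := (abs_pos.2 h1).trans_le this
    rw [halfWidth, mul_assoc]
    positivity
  rcases lt_or_gt_of_ne hne with h | h
  · have hd := (hasFDerivAt_coord 1 y).const_mul (-(1 - lam))
    refine (hd.congr_of_eventuallyEq ?_).congr_fderiv ?_
    · filter_upwards [hc1.abs.continuousAt.eventually_lt hc.continuousAt h] with z hz
      exact profile_eq_of_abs_le hz.le
    · ext v
      simp [profileGrad, h.le, PiLp.inner_apply]
      ring
  · rcases lt_or_gt_of_ne h1 with hs | hs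
    · rw [abs_of_neg hs] at h
      have hd := ((hasFDerivAt_coord 1 y).const_mul lam).add hw
      refine (hd.congr_of_eventuallyEq ?_).congr_fderiv ?_
      · filter_upwards [hc.continuousAt.eventually_lt hc1.neg.continuousAt h,
          continuousAt_const.eventually_lt hc.continuousAt hpos] with z hz hz'
        exact profile_eq_of_le_neg hz'.le hz.le
      · ext v
        simp [profileGrad, abs_of_neg hs, not_le.2 h, sign_neg hs, PiLp.inner_apply, Fin.sum_univ_three]
        ring
    · rw [abs_of_pos hs] at h
      have hd := ((hasFDerivAt_coord 1 y).const_mul lam).sub hw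
      refine (hd.congr_of_eventuallyEq ?_).congr_fderiv ?_
      · filter_upwards [hc.continuousAt.eventually_lt hc1.continuousAt h,
          continuousAt_const.eventually_lt hc.continuousAt hpos] with z hz hz'
        exact profile_eq_of_le hz'.le hz.le
      · ext v
        simp [profileGrad, abs_of_pos hs, not_le.2 h, sign_pos hs, PiLp.inner_apply, Fin.sum_univ_three]
        ring

lemma ae_affine_ne_zero (a₀ a₁ a₂ c : ℝ) (ha : ¬ (a₀ = 0 ∧ a₁ = 0 ∧ a₂ = 0)) :
    ∀ᵐ y : Euc 3, a₀ * y 0 + a₁ * y 1 + a₂ * y 2 + c ≠ 0 := by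
  let f : Euc 3 →ₗ[ℝ] ℝ := innerₛₗ ℝ (!₂[a₀, a₁, a₂] : Euc 3)
  have hf (y : Euc 3) : f y = a₀ * y 0 + a₁ * y 1 + a₂ * y 2 := by
    simp [f, PiLp.inner_apply, Fin.sum_univ_three]; ring
  let S : AffineSubspace ℝ (Euc 3) := (AffineSubspace.mk' (-c) ⊥).comap f.toAffineMap
  have hmem (y : Euc 3) : y ∈ S ↔ a₀ * y 0 + a₁ * y 1 + a₂ * y 2 + c = 0 := by
    simp [S, AffineSubspace.mem_comap, AffineSubspace.mem_mk', hf]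
  have hS : S ≠ ⊤ := by
    intro h
    have key (y : Euc 3) : a₀ * y 0 + a₁ * y 1 + a₂ * y 2 + c = 0 := (hmem y).1 (h ▸ trivial)
    have k := key 0
    have k0 := key (EuclideanSpace.single 0 1)
    have k1 := key (EuclideanSpace.single 1 1)
    have k2 := key (EuclideanSpace.single 2 1)
    simp at k k0 k1 k2
    exact ha ⟨by linarith, by linarith, by linarith⟩
  have := Measure.addHaar_affineSubspace (volume : Measure (Euc 3)) S hS
  rw [ae_iff]
  convert this using 2
  ext y
  simp [hmem]

lemma ae_hasFDerivAt_profile {lam δ : ℝ} (hl : 0 < lam) (hδ : 0 < δ) :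
    ∀ᵐ y : Euc 3, diamondGauge δ y ≤ 1 →
      HasFDerivAt (profile lam δ) (innerSL ℝ (profileGrad lam δ y)) y := by
  have hne : ∀ᵐ y : Euc 3, ∀ s : Bool × Bool × Bool,
      (lam * δ * boolSign s.1) * y 0 + boolSign s.2.1 * y 1 + (lam * δ * boolSign s.2.2) * y 2
        + -(lam * δ) ≠ 0 := by
    rw [ae_all_iff]
    rintro ⟨s₀, s₁, s₂⟩
    refine ae_affine_ne_zero _ _ _ _ fun h => ?_
    have := boolSign_mul_self s₁
    simp [h.2.1] at this
  filter_upwards [hne, ae_affine_ne_zero 1 0 0 0 (by simp), ae_affine_ne_zero 0 1 0 0 (by simp),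
    ae_affine_ne_zero 0 0 1 0 (by simp)] with y hy h0 h1 h2 hD
  refine hasFDerivAt_profile hl hδ hD (by simpa using h0) (by simpa using h1) (by simpa using h2) ?_
  intro h
  obtain ⟨s₀, e₀⟩ := exists_boolSign (y 0)
  obtain ⟨s₁, e₁⟩ := exists_boolSign (y 1)
  obtain ⟨s₂, e₂⟩ := exists_boolSign (y 2)
  apply hy (s₀, s₁, s₂)
  have q₀ := boolSign_mul_self s₀
  have q₁ := boolSign_mul_self s₁
  have q₂ := boolSign_mul_self s₂
  rw [halfWidth] at h
  rw [e₀, e₁, e₂]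
  linear_combination h + lam * δ * |y 0| * q₀ + |y 1| * q₁ + lam * δ * |y 2| * q₂

/-! ### Polytopes and volumes -/

/-- The vertices of the thin diamond (index `none`), and of the tetrahedra filling its complement
in the diamond of aspect ratio `1:δ:1`, one in each octant. -/
def pieceVertices (lam δ : ℝ) : Option (Bool × Bool × Bool) → Set (Euc 3)
  | none => diamondVertices 3 (lam * δ)
  | some s => {axisVertex 0 1 s.1, axisVertex 2 1 s.2.2, axisVertex 1 (lam * δ) s.2.1,
      axisVertex 1 δ s.2.1}

lemma finite_diamondVertices (n : ℕ) (δ : ℝ) : (diamondVertices n δ).Finite := by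
  let f (i : Fin n) : Euc n := (if (i : ℕ) = 1 then δ else 1) • EuclideanSpace.single i (1 : ℝ)
  refine ((finite_range f).union (finite_range (-f))).subset ?_
  rintro v ⟨i, rfl | rfl⟩
  · exact Or.inl ⟨i, rfl⟩
  · exact Or.inr ⟨i, rfl⟩

lemma finite_pieceVertices (lam δ : ℝ) (i : Option (Bool × Bool × Bool)) :
    (pieceVertices lam δ i).Finite := by
  cases i
  · exact finite_diamondVertices _ _
  · simp [pieceVertices]

lemma diamond_subset_iUnion_pieces {lam δ : ℝ} (hl : lam ∈ Ioo 0 1) (hδ : 0 < δ) :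
    {y | diamondGauge δ y ≤ 1} ⊆ ⋃ i, convexHull ℝ (pieceVertices lam δ i) := by
  intro y hy
  have hld : 0 < lam * δ := mul_pos hl.1 hδ
  rw [mem_iUnion]
  by_cases h : diamondGauge (lam * δ) y ≤ 1
  · refine ⟨none, ?_⟩
    change y ∈ baseDiamond 3 (lam * δ)
    rwa [baseDiamond_eq hld]
  · rw [diamondGauge_le_one_iff hl.1 hδ, not_le, halfWidth] at h
    have hy' := abs_le_mul_of_diamondGauge_le_one hδ hy
    obtain ⟨s₀, h₀⟩ := exists_boolSign (y 0)
    obtain ⟨s₁, h₁⟩ := exists_boolSign (y 1)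
    obtain ⟨s₂, h₂⟩ := exists_boolSign (y 2)
    have hl1 : 0 < 1 - lam := by linarith [hl.2]
    refine ⟨some (s₀, s₁, s₂), ?_⟩
    set k := 1 - |y 0| - |y 2| with hk
    have hw2 : 0 ≤ (δ * k - |y 1|) / (δ * (1 - lam)) := div_nonneg (by linarith) (by positivity)
    have hw3 : 0 ≤ (|y 1| - lam * δ * k) / (δ * (1 - lam)) :=
      div_nonneg (by linarith) (by positivity)
    have := Convex.combination_four_mem (convex_convexHull ℝ (pieceVertices lam δ (some (s₀, s₁, s₂))))
      (z₀ := axisVertex 0 1 s₀) (z₁ := axisVertex 2 1 s₂) (z₂ := axisVertex 1 (lam * δ) s₁)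
      (z₃ := axisVertex 1 δ s₁) (subset_convexHull ℝ _ (by simp [pieceVertices]))
      (subset_convexHull ℝ _ (by simp [pieceVertices]))
      (subset_convexHull ℝ _ (by simp [pieceVertices]))
      (subset_convexHull ℝ _ (by simp [pieceVertices]))
      (abs_nonneg (y 0)) (abs_nonneg (y 2)) hw2 hw3 (by field_simp; rw [hk]; ring)
    refine Eq.subst (motive := fun z => z ∈ convexHull ℝ _) ?_ this
    ext j
    fin_cases j
    · simpa [axisVertex, mul_comm] using h₀.symm
    · simp [axisVertex]
      rw [← sub_eq_zero]
      nth_rewrite 3 [h₁]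
      field_simp
      ring
    · simpa [axisVertex, mul_comm] using h₂.symm

lemma convexHull_outer_piece_subset {lam δ : ℝ} (hl : lam ∈ Ioo 0 1) (hδ : 0 < δ)
    (s₀ s₁ s₂ : Bool) :
    convexHull ℝ (pieceVertices lam δ (some (s₀, s₁, s₂))) ⊆
      {y | 0 ≤ boolSign s₀ * y 0 ∧ 0 ≤ boolSign s₂ * y 2 ∧
        0 ≤ 1 - boolSign s₀ * y 0 - boolSign s₂ * y 2 ∧
        0 ≤ boolSign s₁ * y 1 - lam * δ * (1 - boolSign s₀ * y 0 - boolSign s₂ * y 2)} := by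
  have hld : 0 < lam * δ := mul_pos hl.1 hδ
  have hle : lam * δ ≤ δ := mul_le_of_le_one_left hδ.le hl.2.le
  refine convexHull_min ?_ ?_
  · have h₀ := boolSign_mul_self s₀
    have h₁ := boolSign_mul_self s₁
    have h₂ := boolSign_mul_self s₂
    intro y hy
    simp only [pieceVertices, mem_insert_iff, mem_singleton_iff] at hy
    rcases hy with rfl | rfl | rfl | rfl <;>
      simp [axisVertex, h₀, h₁, h₂, ← mul_assoc, hle]
  · intro x hx y hy p q hp hq hpq
    simp only [mem_ofPred_eq, PiLp.add_apply, PiLp.smul_apply, smul_eq_mul] at *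
    obtain ⟨x1, x2, x3, x4⟩ := hx
    obtain ⟨y1, y2, y3, y4⟩ := hy
    obtain rfl : q = 1 - p := by linarith
    refine ⟨?_, ?_, ?_, ?_⟩
    · linear_combination p * x1 + (1 - p) * y1
    · linear_combination p * x2 + (1 - p) * y2
    · linear_combination p * x3 + (1 - p) * y3
    · linear_combination p * x4 + (1 - p) * y4

lemma profile_affine_on_piece {lam δ : ℝ} (hl : lam ∈ Ioo 0 1) (hδ : 0 < δ)
    (i : Option (Bool × Bool × Bool)) :
    ∃ (f : Euc 3 →ₗ[ℝ] ℝ) (c : ℝ), ∀ y ∈ convexHull ℝ (pieceVertices lam δ i),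
      profile lam δ y = f y + c := by
  rcases i with _ | ⟨s₀, s₁, s₂⟩
  · refine ⟨innerₛₗ ℝ (EuclideanSpace.single 1 (-(1 - lam))), 0, fun y hy => ?_⟩
    change y ∈ baseDiamond 3 (lam * δ) at hy
    rw [baseDiamond_eq (mul_pos hl.1 hδ), mem_ofPred_eq, diamondGauge_le_one_iff hl.1 hδ] at hy
    rw [profile_eq_of_abs_le hy]
    simp [PiLp.inner_apply]
    ring
  · refine ⟨innerₛₗ ℝ !₂[boolSign s₁ * (lam * δ * boolSign s₀), lam,
      boolSign s₁ * (lam * δ * boolSign s₂)], -(boolSign s₁ * (lam * δ)), fun y hy => ?_⟩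
    obtain ⟨h₀, h₂, hr, h₁⟩ := convexHull_outer_piece_subset hl hδ s₀ s₁ s₂ hy
    have hld : 0 < lam * δ := mul_pos hl.1 hδ
    have hw : halfWidth lam δ y = lam * δ * (1 - boolSign s₀ * y 0 - boolSign s₂ * y 2) := by
      rw [halfWidth, abs_eq_boolSign_mul h₀, abs_eq_boolSign_mul h₂]
    rw [← hw] at h₁
    have hw0 : 0 ≤ halfWidth lam δ y := by rw [hw]; positivity
    have key : profile lam δ y = lam * y 1 - boolSign s₁ * halfWidth lam δ y := by
      cases s₁
      · simp only [boolSign, Bool.false_eq_true, if_false] at h₁ ⊢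
        rw [profile_eq_of_le_neg hw0 (by linarith)]; ring
      · simp only [boolSign, if_true] at h₁ ⊢
        rw [profile_eq_of_le hw0 (by linarith)]; ring
    rw [key, hw]
    simp [PiLp.inner_apply, Fin.sum_univ_three]
    ring

lemma volume_thin_diamond {lam δ : ℝ} (hl : 0 < lam) :
    volume {y | diamondGauge (lam * δ) y ≤ 1} =
      ENNReal.ofReal lam * volume {y | diamondGauge δ y ≤ 1} := by
  let T : Euc 3 →ₗ[ℝ] Euc 3 := Matrix.toEuclideanLin (Matrix.diagonal ![1, lam⁻¹, 1])
  have hdet : LinearMap.det T = lam⁻¹ := by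
    simp only [T]
    rw [Matrix.toEuclideanLin_eq_toLin_orthonormal, LinearMap.det_toLin]
    simp [Fin.prod_univ_three]
  have hpre : {y | diamondGauge (lam * δ) y ≤ 1} = T ⁻¹' {y | diamondGauge δ y ≤ 1} := by
    ext y
    have h0 : T y 0 = y 0 := by simp [T, Matrix.toLpLin_apply, Matrix.mulVec_diagonal]
    have h1 : T y 1 = lam⁻¹ * y 1 := by simp [T, Matrix.toLpLin_apply, Matrix.mulVec_diagonal]
    have h2 : T y 2 = y 2 := by simp [T, Matrix.toLpLin_apply, Matrix.mulVec_diagonal]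
    have h3 : |lam⁻¹ * y 1| / δ = |y 1| / (lam * δ) := by
      rw [abs_mul, abs_of_pos (inv_pos.2 hl)]; field_simp
    simp only [mem_preimage, mem_ofPred_eq, diamondGauge, h0, h1, h2, h3]
  rw [hpre, Measure.addHaar_preimage_linearMap _ (by rw [hdet]; positivity), hdet, inv_inv,
    abs_of_pos hl]

/-! ### Matrices and frames -/

lemma matCLM_apply {n : ℕ} (M : Mat n) (x : Euc n) :
    matCLM M x = WithLp.toLp 2 (M.mulVec x.ofLp) := by
  simp [matCLM, Matrix.toLpLin_apply]

lemma matCLM_add {n : ℕ} (M N : Mat n) : matCLM (M + N) = matCLM M + matCLM N := by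
  simp [matCLM]

lemma matCLM_vecMulVec {n : ℕ} (a w x : Euc n) :
    matCLM (Matrix.vecMulVec a.ofLp w.ofLp) x = inner ℝ w x • a := by
  rw [matCLM_apply]
  ext i
  simp [Matrix.vecMulVec_mulVec, PiLp.inner_apply, dotProduct, mul_comm]

lemma frobNorm_vecMulVec {n : ℕ} (a w : Euc n) :
    frobNorm (Matrix.vecMulVec a.ofLp w.ofLp) = ‖a‖ * ‖w‖ := by
  rw [frobNorm, EuclideanSpace.norm_eq, EuclideanSpace.norm_eq, ← Real.sqrt_mul (by positivity),
    Finset.sum_mul_sum]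
  simp [Matrix.vecMulVec_apply, mul_pow]

lemma frobNorm_zero {n : ℕ} : frobNorm (0 : Mat n) = 0 := by simp [frobNorm]

/-- The matrix whose columns are the vectors of an orthonormal basis. -/
def frameMatrix {n : ℕ} (b : OrthonormalBasis (Fin n) ℝ (Euc n)) : Mat n :=
  Matrix.of fun i j => b j i

lemma frameMatrix_transpose_mul_self {n : ℕ} (b : OrthonormalBasis (Fin n) ℝ (Euc n)) :
    (frameMatrix b)ᵀ * frameMatrix b = 1 := by
  ext i j
  have := orthonormal_iff_ite.1 b.orthonormal i j
  rw [PiLp.inner_apply] at this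
  simpa [frameMatrix, Matrix.mul_apply, Matrix.one_apply, mul_comm] using this

lemma matVec_frameMatrix {n : ℕ} (b : OrthonormalBasis (Fin n) ℝ (Euc n)) (y : Euc n) :
    matVec (frameMatrix b) y = b.repr.symm y := by
  rw [matVec, matCLM_apply, ← b.sum_repr_symm y]
  ext i
  simp [frameMatrix, Matrix.mulVec, dotProduct, mul_comm]

lemma repr_symm_single {n : ℕ} (b : OrthonormalBasis (Fin n) ℝ (Euc n)) (i : Fin n) (t : ℝ) :
    b.repr.symm (EuclideanSpace.single i t) = t • b i := by
  rw [LinearIsometryEquiv.symm_apply_eq, map_smul, b.repr_self]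
  ext j
  by_cases h : j = i <;> simp [h]

lemma isDiamond_preimage_repr (b : OrthonormalBasis (Fin 3) ℝ (Euc 3))
    (hb : (frameMatrix b).det = 1) {δ : ℝ} (hδ : 0 < δ) :
    IsDiamond 3 δ {x | diamondGauge δ (b.repr x) ≤ 1} := by
  refine ⟨0, 1, frameMatrix b, one_pos, frameMatrix_transpose_mul_self b, hb, ?_⟩
  rw [baseDiamond_eq hδ]
  ext x
  simp only [matVec_frameMatrix, one_smul, zero_add, mem_image, mem_ofPred_eq]
  constructor
  · intro h
    exact ⟨b.repr x, h, by simp⟩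
  · rintro ⟨y, hy, rfl⟩
    simpa using hy

lemma exists_frame_one (nv : Euc 3) (hnv : ‖nv‖ = 1) :
    ∃ b : OrthonormalBasis (Fin 3) ℝ (Euc 3), b 1 = nv := by
  obtain ⟨b, hb⟩ := Orthonormal.exists_orthonormalBasis_extension_of_card_eq (𝕜 := ℝ)
    (E := Euc 3) (ι := Fin 3) (by simp) (v := fun _ => nv) (s := {1})
    (by simp [Orthonormal, hnv, Subsingleton.pairwise])
  exact ⟨b, hb 1 rfl⟩

lemma exists_oriented_frame (nv : Euc 3) (hnv : ‖nv‖ = 1) :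
    ∃ b : OrthonormalBasis (Fin 3) ℝ (Euc 3),
      (frameMatrix b).det = 1 ∧ (b 1 = nv ∨ b 1 = -nv) := by
  obtain ⟨b, hb⟩ := exists_frame_one nv hnv
  have hd : (frameMatrix b).det * (frameMatrix b).det = 1 := by
    have := congrArg Matrix.det (frameMatrix_transpose_mul_self b)
    simpa using this
  rcases mul_self_eq_one_iff.1 hd with h | h
  · exact ⟨b, h, Or.inl hb⟩
  · refine ⟨b.map (LinearIsometryEquiv.neg ℝ), ?_, Or.inr (by simp [hb])⟩
    have : frameMatrix (b.map (LinearIsometryEquiv.neg ℝ)) = -frameMatrix b := by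
      ext i j; simp [frameMatrix]
    rw [this, Matrix.det_neg, h]
    norm_num

/-! ### The laminate -/

section Laminate

variable (C : Mat 3) (a : Euc 3) (b : OrthonormalBasis (Fin 3) ℝ (Euc 3)) (lam δ : ℝ)

/-- The affine map `C` perturbed by the scalar profile in the direction `a`. -/
def laminate (x : Euc 3) : Euc 3 := matVec C x + profile lam δ (b.repr x) • a

/-- The gradient of the laminate. -/
def laminateGrad (x : Euc 3) : Mat 3 :=
  C + Matrix.vecMulVec a.ofLp (b.repr.symm (profileGrad lam δ (b.repr x))).ofLp

variable {lam δ}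

lemma exists_lipschitzWith_laminate : ∃ L, LipschitzWith L (laminate C a b lam δ) := by
  obtain ⟨L, hL⟩ := exists_lipschitzWith_profile lam δ
  have h1 := ((ContinuousLinearMap.toSpanSingleton ℝ a).lipschitz.comp hL).comp
    b.repr.lipschitz
  exact ⟨_, (matCLM C).lipschitz.add h1⟩

lemma isPiecewiseAffine_laminate (hl : lam ∈ Ioo 0 1) (hδ : 0 < δ) :
    IsPiecewiseAffine {x | diamondGauge δ (b.repr x) ≤ 1} (laminate C a b lam δ) := by
  obtain ⟨L, hL⟩ := exists_lipschitzWith_laminate C a b (lam := lam) (δ := δ)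
  let σ := (Fintype.equivFin (Option (Bool × Bool × Bool))).symm
  let S (i) := b.repr.symm.toLinearEquiv.toLinearMap '' pieceVertices lam δ (σ i)
  have hS (i) : (S i).Finite := (finite_pieceVertices lam δ (σ i)).image _
  have hP (i) : convexHull ℝ (S i) = b.repr.symm '' convexHull ℝ (pieceVertices lam δ (σ i)) :=
    (LinearMap.image_convexHull _ _).symm
  refine ⟨hL.continuous.continuousOn, _, fun i => convexHull ℝ (S i),
    fun i => ⟨(hS i).toFinset, by simp⟩, fun x hx => ?_, fun i => ?_⟩
  · obtain ⟨i, hi⟩ := mem_iUnion.1 (diamond_subset_iUnion_pieces hl hδ hx)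
    refine mem_iUnion.2 ⟨σ.symm i, ?_⟩
    rw [hP]
    exact ⟨b.repr x, by simpa using hi, by simp⟩
  · obtain ⟨f, c, hf⟩ := profile_affine_on_piece hl hδ (σ i)
    refine ⟨(matCLM C).toLinearMap + (f ∘ₗ b.repr.toLinearEquiv.toLinearMap).smulRight a, c • a,
      fun x hx => ?_⟩
    have hx' : x ∈ convexHull ℝ (S i) := hx.1
    rw [hP] at hx'
    obtain ⟨y, hy, rfl⟩ := hx'
    simp [laminate, matVec, hf y hy, add_smul, add_assoc]

lemma laminate_eq_on_frontier (hl : lam ∈ Ioo 0 1) (hδ : 0 < δ) {x : Euc 3}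
    (hx : x ∈ frontier {x | diamondGauge δ (b.repr x) ≤ 1}) :
    laminate C a b lam δ x = matVec C x := by
  have h := frontier_le_subset_eq ((continuous_diamondGauge δ).comp b.repr.continuous)
    continuous_const hx
  rw [laminate, profile_eq_zero hl hδ h, zero_smul, add_zero]

lemma ae_hasFDerivAt_laminate (hl : 0 < lam) (hδ : 0 < δ) :
    ∀ᵐ x, x ∈ {x | diamondGauge δ (b.repr x) ≤ 1} →
      HasFDerivAt (laminate C a b lam δ) (matCLM (laminateGrad C a b lam δ x)) x := by
  filter_upwards [b.measurePreserving_repr.quasiMeasurePreserving.ae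
    (ae_hasFDerivAt_profile hl hδ)] with x hx hD
  have h1 := (hx hD).comp x b.repr.toContinuousLinearEquiv.hasFDerivAt
  refine ((matCLM C).hasFDerivAt.add (h1.smul_const a)).congr_fderiv ?_
  ext1 v
  rw [laminateGrad, matCLM_add]
  simp only [_root_.add_apply, matCLM_vecMulVec]
  congr 2
  rw [← b.repr.inner_map_map]
  simp

lemma norm_laminate_sub_le (hl : lam ∈ Ioo 0 1) (hδ : 0 < δ) {x : Euc 3}
    (hx : diamondGauge δ (b.repr x) ≤ 1) :
    ‖laminate C a b lam δ x - matVec C x‖ ≤ δ * lam * (1 - lam) * ‖a‖ := by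
  rw [laminate, add_sub_cancel_left, norm_smul]
  exact mul_le_mul_of_nonneg_right (abs_profile_le hl hδ hx) (norm_nonneg _)

variable {C a b} {A B : Mat 3}

lemma laminateGrad_eq_of_abs_le (hAB : A - B = Matrix.vecMulVec a.ofLp (b 1).ofLp)
    (hC : C = (1 - lam) • A + lam • B) {x : Euc 3}
    (hx : |b.repr x 1| ≤ halfWidth lam δ (b.repr x)) : laminateGrad C a b lam δ x = B := by
  rw [laminateGrad, profileGrad, if_pos hx, repr_symm_single, WithLp.ofLp_smul,
    Matrix.vecMulVec_smul, ← hAB, hC]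
  module

lemma frobNorm_laminateGrad_sub_le (hl : 0 < lam) (hδ : 0 < δ)
    (hAB : A - B = Matrix.vecMulVec a.ofLp (b 1).ofLp)
    (hC : C = (1 - lam) • A + lam • B) {x : Euc 3}
    (hx : ¬ |b.repr x 1| ≤ halfWidth lam δ (b.repr x)) :
    frobNorm (laminateGrad C a b lam δ x - A) ≤ Real.sqrt 2 * (lam * δ) * ‖a‖ := by
  have : laminateGrad C a b lam δ x - A = Matrix.vecMulVec a.ofLp
      (b.repr.symm (profileGrad lam δ (b.repr x) - EuclideanSpace.single 1 lam)).ofLp := by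
    rw [map_sub, repr_symm_single, WithLp.ofLp_sub, Matrix.vecMulVec_sub, WithLp.ofLp_smul,
      Matrix.vecMulVec_smul, ← hAB, laminateGrad, hC]
    module
  rw [this, frobNorm_vecMulVec, LinearIsometryEquiv.norm_map, mul_comm]
  exact mul_le_mul_of_nonneg_right (norm_profileGrad_sub_le hl hδ hx) (norm_nonneg _)

end Laminate

/-- The building block with gradient equal to `B` off the phase close to `A`, when `A - B` is a rank-one
matrix in the direction of the second vector of an oriented frame. -/
theorem exists_laminate_of_frame {A B : Mat 3} {a : Euc 3}
    {b : OrthonormalBasis (Fin 3) ℝ (Euc 3)} (hb : (frameMatrix b).det = 1) (ha : a ≠ 0)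
    (hAB : A - B = Matrix.vecMulVec a.ofLp (b 1).ofLp) {lam δ : ℝ} (hl : lam ∈ Ioo 0 1)
    (hδ : 0 < δ) (hsmall : Real.sqrt 2 * (lam * δ) < 1) {C : Mat 3}
    (hC : C = (1 - lam) • A + lam • B) :
    ∃ (Ω : Set (Euc 3)) (u : Euc 3 → Euc 3) (g : Euc 3 → Mat 3) (V : Set (Mat 3)),
      IsDiamond 3 δ Ω ∧ IsPiecewiseAffine Ω u ∧ (∃ L : NNReal, LipschitzOnWith L u Ω) ∧
      (∀ x ∈ frontier Ω, u x = matVec C x) ∧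
      (∀ᵐ x, x ∈ Ω → HasFDerivAt u (matCLM (g x)) x) ∧
      (∀ x ∈ Ω, ‖u x - matVec C x‖ ≤ δ * lam * (1 - lam) * ‖a‖) ∧
      (∀ x, g x ∈ V → frobNorm (g x - A) ≤ Real.sqrt 2 * (lam * δ) * ‖a‖) ∧
      (∀ x, g x ∉ V → g x = B) ∧
      volume {x ∈ Ω | g x ∈ V} = ENNReal.ofReal (1 - lam) * volume Ω ∧
      volume {x ∈ Ω | g x ∉ V} = ENNReal.ofReal lam * volume Ω := by
  obtain ⟨L, hL⟩ := exists_lipschitzWith_laminate C a b (lam := lam) (δ := δ)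
  set Ω : Set (Euc 3) := {x | diamondGauge δ (b.repr x) ≤ 1} with hΩ
  let V : Set (Mat 3) := {M | frobNorm (M - A) ≤ Real.sqrt 2 * (lam * δ) * ‖a‖}
  have hV (x : Euc 3) : laminateGrad C a b lam δ x ∉ V ↔
      |b.repr x 1| ≤ halfWidth lam δ (b.repr x) := by
    constructor
    · intro h
      by_contra hc
      exact h (frobNorm_laminateGrad_sub_le hl.1 hδ hAB hC hc)
    · intro h
      have hBA : B - A = Matrix.vecMulVec (-a).ofLp (b 1).ofLp := by
        rw [WithLp.ofLp_neg, Matrix.neg_vecMulVec, ← hAB, neg_sub]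
      rw [laminateGrad_eq_of_abs_le hAB hC h, mem_ofPred_eq, hBA, frobNorm_vecMulVec, norm_neg,
        b.norm_eq_one, mul_one, not_le]
      exact mul_lt_of_lt_one_left (norm_pos_iff.2 ha) hsmall
  let W (c : ℝ) : Set (Euc 3) := {y | diamondGauge c y ≤ 1}
  have hWc (c : ℝ) : IsClosed (W c) := isClosed_le (continuous_diamondGauge c) continuous_const
  have hin : {x ∈ Ω | laminateGrad C a b lam δ x ∉ V} = b.repr ⁻¹' W (lam * δ) := by
    ext x
    simp only [hΩ, W, mem_ofPred_eq, mem_preimage, hV, diamondGauge_le_one_iff hl.1 hδ]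
    refine and_iff_right_of_imp fun h => ?_
    rw [← diamondGauge_le_one_iff hl.1 hδ] at h
    refine le_trans ?_ h
    unfold diamondGauge
    have : lam * δ ≤ δ := mul_le_of_le_one_left hδ.le hl.2.le
    have := mul_pos hl.1 hδ
    gcongr
  have hvol (c : ℝ) : volume (b.repr ⁻¹' W c) = volume (W c) :=
    b.measurePreserving_repr.measure_preimage (hWc c).measurableSet.nullMeasurableSet
  have hvin : volume {x ∈ Ω | laminateGrad C a b lam δ x ∉ V} = ENNReal.ofReal lam * volume Ω := by
    rw [hin, hvol, volume_thin_diamond hl.1, ← hvol δ]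
    rfl
  have hfin : volume Ω ≠ ∞ := by
    have h : volume Ω = volume (W δ) := hvol δ
    have hbd : IsCompact (W δ) := by
      have := (finite_diamondVertices 3 δ).isCompact_convexHull ℝ
      rwa [← baseDiamond, baseDiamond_eq hδ] at this
    rw [h]
    exact hbd.measure_lt_top.ne
  refine ⟨Ω, laminate C a b lam δ, laminateGrad C a b lam δ, V, isDiamond_preimage_repr b hb hδ,
    isPiecewiseAffine_laminate C a b hl hδ, ⟨L, hL.lipschitzOnWith⟩,
    fun x hx => laminate_eq_on_frontier C a b hl hδ hx, ae_hasFDerivAt_laminate C a b hl.1 hδ,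
    fun x hx => norm_laminate_sub_le C a b hl hδ hx, fun x hx => hx,
    fun x hx => laminateGrad_eq_of_abs_le hAB hC ((hV x).1 hx), ?_, hvin⟩
  have hdiff : {x ∈ Ω | laminateGrad C a b lam δ x ∈ V} =
      Ω \ {x ∈ Ω | laminateGrad C a b lam δ x ∉ V} := by
    ext x
    simp only [mem_sdiff, mem_ofPred_eq]
    tauto
  have hmeas : MeasurableSet {x ∈ Ω | laminateGrad C a b lam δ x ∉ V} := by
    rw [hin]
    exact b.measurePreserving_repr.measurable (hWc _).measurableSet
  rw [hdiff, measure_sdiff (fun x hx => hx.1) hmeas.nullMeasurableSet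
    (ne_top_of_le_ne_top hfin (measure_mono fun x hx => hx.1)), hvin,
    ENNReal.ofReal_sub _ hl.1.le, ENNReal.ofReal_one,
    ENNReal.sub_mul (fun _ _ => hfin), one_mul]

/-- The building block with gradient equal to `B` off the phase close to `A`, for an arbitrary unit
normal. -/
theorem exists_laminate {A B : Mat 3} {a nv : Euc 3} (ha : a ≠ 0) (hnv : ‖nv‖ = 1)
    (hAB : A - B = Matrix.vecMulVec a.ofLp nv.ofLp) {lam δ : ℝ} (hl : lam ∈ Ioo 0 1)
    (hδ : 0 < δ) (hsmall : Real.sqrt 2 * (lam * δ) < 1) {C : Mat 3}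
    (hC : C = (1 - lam) • A + lam • B) :
    ∃ (Ω : Set (Euc 3)) (u : Euc 3 → Euc 3) (g : Euc 3 → Mat 3) (V : Set (Mat 3)),
      IsDiamond 3 δ Ω ∧ IsPiecewiseAffine Ω u ∧ (∃ L : NNReal, LipschitzOnWith L u Ω) ∧
      (∀ x ∈ frontier Ω, u x = matVec C x) ∧
      (∀ᵐ x, x ∈ Ω → HasFDerivAt u (matCLM (g x)) x) ∧
      (∀ x ∈ Ω, ‖u x - matVec C x‖ ≤ δ * lam * (1 - lam) * ‖a‖) ∧
      (∀ x, g x ∈ V → frobNorm (g x - A) ≤ Real.sqrt 2 * (lam * δ) * ‖a‖) ∧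
      (∀ x, g x ∉ V → g x = B) ∧
      volume {x ∈ Ω | g x ∈ V} = ENNReal.ofReal (1 - lam) * volume Ω ∧
      volume {x ∈ Ω | g x ∉ V} = ENNReal.ofReal lam * volume Ω := by
  obtain ⟨b, hb, h | h⟩ := exists_oriented_frame nv hnv
  · exact exists_laminate_of_frame hb ha (by rw [hAB, h]) hl hδ hsmall hC
  · have := exists_laminate_of_frame (a := -a) (A := A) (B := B) hb (neg_ne_zero.2 ha)
      (by rw [hAB, h]; simp [Matrix.neg_vecMulVec, Matrix.vecMulVec_neg]) hl hδ hsmall hC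
    simpa only [norm_neg] using this

/-- The 3D replacement construction (building block) without trace constraint:
for rank-one connected `A, B` and `C₀ = (1−λ)A + λB` and any `δ ∈ (0,1/2)` there are
a diamond `Ω_δ` of aspect ratio `1:δ:1` and a piecewise affine Lipschitz map `u` with
boundary data `C₀x`, gradient `ε`-close to `{A,B}` for `ε = 4√2·δ·λ(1−λ)|a|`, and the
stated volume fractions for the region near `A` (a union of level sets of `∇u`). -/
theorem building_block_3D (A B : Mat 3) (a nv : Euc 3)
    (ha : a ≠ 0) (hnv : ‖nv‖ = 1)
    (hAB : A - B = Matrix.vecMulVec (fun i => a i) (fun j => nv j))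
    (lam : ℝ) (hlam : lam ∈ Set.Ioo (0 : ℝ) 1)
    (C₀ : Mat 3) (hC₀ : C₀ = (1 - lam) • A + lam • B)
    (δ : ℝ) (hδ : δ ∈ Set.Ioo (0 : ℝ) (1/2)) :
    ∃ (Ωδ : Set (Euc 3)) (u : Euc 3 → Euc 3) (g : Euc 3 → Mat 3),
      IsDiamond 3 δ Ωδ ∧
      IsPiecewiseAffine Ωδ u ∧ (∃ L : NNReal, LipschitzOnWith L u Ωδ) ∧
      (∀ x ∈ frontier Ωδ, u x = matVec C₀ x) ∧
      (∀ᵐ x, x ∈ Ωδ → HasFDerivAt u (matCLM (g x)) x) ∧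
      (∀ᵐ x, x ∈ Ωδ →
        min (frobNorm (g x - A)) (frobNorm (g x - B))
            ≤ 4 * Real.sqrt 2 * δ * lam * (1 - lam) * ‖a‖ ∧
        ‖u x - matVec C₀ x‖ ≤ 4 * Real.sqrt 2 * δ * lam * (1 - lam) * ‖a‖) ∧
      ∃ Ω' ⊆ Ωδ, (∃ V : Set (Mat 3), Ω' = {x ∈ Ωδ | g x ∈ V}) ∧
        ∃ vA ∈ Set.Ioo (1/2 : ℝ) 2, ∃ vB ∈ Set.Ioo (1/2 : ℝ) 2,
          (∀ᵐ x, x ∈ Ω' →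
            frobNorm (g x - A) ≤ 4 * Real.sqrt 2 * δ * lam * (1 - lam) * ‖a‖) ∧
          volume Ω' = ENNReal.ofReal ((1 - lam) * vA) * volume Ωδ ∧
          (∀ᵐ x, x ∈ Ωδ \ Ω' →
            frobNorm (g x - B) ≤ 4 * Real.sqrt 2 * δ * lam * (1 - lam) * ‖a‖) ∧
          volume (Ωδ \ Ω') = ENNReal.ofReal (lam * vB) * volume Ωδ := by
  obtain ⟨hl0, hl1⟩ := hlam
  obtain ⟨hδ0, hδ1⟩ := hδ
  have h2 : 1 ≤ Real.sqrt 2 := Real.one_le_sqrt.2 (by norm_num)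
  have h2' : Real.sqrt 2 ≤ 2 := Real.sqrt_le_iff.2 (by norm_num)
  have hna := norm_nonneg a
  set ε := 4 * Real.sqrt 2 * δ * lam * (1 - lam) * ‖a‖ with hε
  have hsmall {t : ℝ} (h0 : 0 < t) (h1 : t < 1) : Real.sqrt 2 * (t * δ) < 1 := by
    nlinarith [mul_lt_mul'' h1 hδ1 h0.le hδ0.le, mul_pos h0 hδ0]
  have hle1 : δ * lam * (1 - lam) * ‖a‖ ≤ ε := by
    have : 0 ≤ δ * lam * (1 - lam) * ‖a‖ := by
      have : 0 < 1 - lam := by linarith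
      positivity
    rw [hε]; nlinarith
  have hle2 {s t : ℝ} (ht : 0 ≤ t) (hs : 1 ≤ 4 * s) (h : s * t = lam * (1 - lam)) :
      Real.sqrt 2 * (t * δ) * ‖a‖ ≤ ε := by
    have : 0 ≤ Real.sqrt 2 * (t * δ) * ‖a‖ := by positivity
    calc _ ≤ (4 * s) * (Real.sqrt 2 * (t * δ) * ‖a‖) := le_mul_of_one_le_left this hs
      _ = ε := by rw [hε]; linear_combination 4 * Real.sqrt 2 * δ * ‖a‖ * h
  have hε0 : 0 ≤ ε := by
    have : 0 < 1 - lam := by linarith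
    positivity
  have hdiff (Ω : Set (Euc 3)) (g : Euc 3 → Mat 3) (V : Set (Mat 3)) :
      Ω \ {x ∈ Ω | g x ∈ V} = {x ∈ Ω | g x ∉ V} := by
    ext x
    simp only [mem_sdiff, mem_ofPred_eq]
    tauto
  suffices ∃ (Ω : Set (Euc 3)) (u : Euc 3 → Euc 3) (g : Euc 3 → Mat 3) (V : Set (Mat 3)),
      IsDiamond 3 δ Ω ∧ IsPiecewiseAffine Ω u ∧ (∃ L : NNReal, LipschitzOnWith L u Ω) ∧
      (∀ x ∈ frontier Ω, u x = matVec C₀ x) ∧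
      (∀ᵐ x, x ∈ Ω → HasFDerivAt u (matCLM (g x)) x) ∧
      (∀ x ∈ Ω, ‖u x - matVec C₀ x‖ ≤ ε) ∧
      (∀ x, g x ∈ V → frobNorm (g x - A) ≤ ε) ∧
      (∀ x, g x ∉ V → frobNorm (g x - B) ≤ ε) ∧
      volume {x ∈ Ω | g x ∈ V} = ENNReal.ofReal (1 - lam) * volume Ω ∧
      volume {x ∈ Ω | g x ∉ V} = ENNReal.ofReal lam * volume Ω by
    obtain ⟨Ω, u, g, V, hΩ, hu, hL, hfr, hder, hC, hgA, hgB, hvA, hvB⟩ := this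
    refine ⟨Ω, u, g, hΩ, hu, hL, hfr, hder, ae_of_all _ fun x hx => ⟨?_, hC x hx⟩,
      {x ∈ Ω | g x ∈ V}, fun x hx => hx.1, ⟨V, rfl⟩, 1, by norm_num, 1, by norm_num,
      ae_of_all _ fun x hx => hgA x hx.2, by rw [mul_one, hvA], ae_of_all _ fun x hx => ?_,
      by rw [mul_one, hdiff, hvB]⟩
    · by_cases h : g x ∈ V
      · exact min_le_of_left_le (hgA x h)
      · exact min_le_of_right_le (hgB x h)
    · rw [hdiff] at hx
      exact hgB x hx.2
  rcases le_total lam (1 / 2) with hl | hl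
  · obtain ⟨Ω, u, g, V, hΩ, hu, hL, hfr, hder, hC, hgA, hgB, hvA, hvB⟩ :=
      exists_laminate ha hnv hAB ⟨hl0, hl1⟩ hδ0 (hsmall hl0 hl1) hC₀
    refine ⟨Ω, u, g, V, hΩ, hu, hL, hfr, hder, fun x hx => (hC x hx).trans hle1,
      fun x hx => (hgA x hx).trans (hle2 (s := 1 - lam) hl0.le (by linarith) (by ring)),
      fun x hx => ?_, hvA, hvB⟩
    rw [hgB x hx, sub_self, frobNorm_zero]
    exact hε0
  · have hBA : B - A = Matrix.vecMulVec (-a).ofLp nv.ofLp := by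
      rw [WithLp.ofLp_neg, Matrix.neg_vecMulVec, ← neg_sub, hAB]
    obtain ⟨Ω, u, g, V, hΩ, hu, hL, hfr, hder, hC, hgB, hgA, hvB, hvA⟩ :=
      exists_laminate (neg_ne_zero.2 ha) hnv hBA (lam := 1 - lam)
        ⟨by linarith, by linarith⟩ hδ0 (hsmall (by linarith) (by linarith)) (C := C₀)
        (by rw [hC₀, _root_.sub_sub_cancel, add_comm])
    rw [norm_neg] at *
    refine ⟨Ω, u, g, Vᶜ, hΩ, hu, hL, hfr, hder, fun x hx => ?_, fun x hx => ?_,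
      fun x hx => (hgB x (not_not.1 hx)).trans
        (hle2 (s := lam) (by linarith) (by linarith) rfl), hvA, ?_⟩
    · refine (hC x hx).trans (le_trans (le_of_eq ?_) hle1)
      ring
    · rw [hgA x hx, sub_self, frobNorm_zero]
      exact hε0
    · simpa only [mem_compl_iff, not_not, _root_.sub_sub_cancel] using hvB
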